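/- There exist τ₀ > 0 and C > 0 depending only on T − t₀, c₀, H₀, C_g := C_c² and C₁,…,C₈ (independent of ω̃, τ, n, d) such that: if the filter functions ψ_E, φ_E satisfy filter conditions (i)–(viii), the initial data satisfy the Initial-data bounds, and the step size satisfies 0 < τ ≤ τ₀ and τ·ω̃ ≥ c₀, then the impulse iterates p_n of the triple splitting scheme and the exact solution p of the semidiscrete Maxwell system satisfy ‖p_n − p(t_n)‖ ≤ C·τ² for all n with t_n := t₀ + n·τ ≤ T. -/

import Mathlib

noncomputable def sinc (z : ℝ) : ℝ := if z = 0 then 1 else Real.sin z / z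

noncomputable def mulE {d : ℕ} (A : Matrix (Fin d) (Fin d) ℝ)
    (v : EuclideanSpace ℝ (Fin d)) : EuclideanSpace ℝ (Fin d) :=
  (WithLp.equiv 2 (Fin d → ℝ)).symm (A.mulVec ((WithLp.equiv 2 (Fin d → ℝ)) v))

noncomputable def fDiag {d : ℕ} (f : ℝ → ℝ) (s : ℝ) (ωv : Fin d → ℝ) :
    Matrix (Fin d) (Fin d) ℝ :=
  Matrix.diagonal fun i => f (s * ωv i)

/-- One step of the triple splitting scheme (with `ψ_B ≡ φ_B ≡ 1`),
acting on a state `(p, e, b)`. -/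
noncomputable def tripleSplitStep {d : ℕ} (CE CB : Matrix (Fin d) (Fin d) ℝ)
    (ψE φE : ℝ → ℝ) (τ : ℝ) (ωv : Fin d → ℝ)
    (s : EuclideanSpace ℝ (Fin d) × EuclideanSpace ℝ (Fin d) × EuclideanSpace ℝ (Fin d)) :
    EuclideanSpace ℝ (Fin d) × EuclideanSpace ℝ (Fin d) × EuclideanSpace ℝ (Fin d) :=
  let p := s.1
  let e := s.2.1
  let b := s.2.2
  let bh := b - (τ/2) • mulE CE (mulE (fDiag φE (τ/2) ωv) e)
  let ep := e + (τ/2) • mulE (fDiag ψE (τ/2) ωv) (mulE CB bh)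
  let p1 := mulE (fDiag Real.cos τ ωv) p + τ • mulE (fDiag sinc τ ωv) ep
  let em := -mulE (Matrix.diagonal fun i => ωv i * Real.sin (τ * ωv i)) p
              + mulE (fDiag Real.cos τ ωv) ep
  let e1 := em + (τ/2) • mulE (fDiag ψE (τ/2) ωv) (mulE CB bh)
  let b1 := bh - (τ/2) • mulE CE (mulE (fDiag φE (τ/2) ωv) e1)
  (p1, e1, b1)

section Gronwall

/-- Discrete Grönwall inequality. -/
theorem discrete_gronwall_le {a : ℕ → ℝ} {δ L : ℝ} (hδ : 0 ≤ δ) (hL : 0 ≤ L) (ha : 0 ≤ a 0)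
    (N : ℕ) (h : ∀ n < N, a (n + 1) ≤ (1 + δ) * a n + L) :
    ∀ n ≤ N, a n ≤ Real.exp (n * δ) * (a 0 + n * L) := by
  intro n
  induction n with
  | zero => simp
  | succ n ih =>
    intro hn
    have h1 := ih (by omega)
    have h2 := h n (by omega)
    have h3 : 1 + δ ≤ Real.exp δ := by linarith [Real.add_one_le_exp δ]
    have h4 : Real.exp ((n + 1 : ℕ) * δ) = Real.exp δ * Real.exp (n * δ) := by
      rw [← Real.exp_add]; push_cast; ring_nf
    have h5 : 1 ≤ Real.exp ((n + 1 : ℕ) * δ) := Real.one_le_exp (by positivity)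
    have h6 : (1 + δ) * a n ≤ Real.exp δ * (Real.exp (n * δ) * (a 0 + n * L)) := by
      calc (1 + δ) * a n ≤ (1 + δ) * (Real.exp (n * δ) * (a 0 + n * L)) := by gcongr
        _ ≤ _ := by gcongr
    calc a (n + 1) ≤ (1 + δ) * a n + L := h2
      _ ≤ Real.exp ((n + 1 : ℕ) * δ) * (a 0 + n * L) + Real.exp ((n + 1 : ℕ) * δ) * L := by
        rw [h4] at h5 ⊢
        nlinarith
      _ = _ := by push_cast; ring

theorem le_mul_exp_of_deriv_le {f f' : ℝ → ℝ} {K : ℝ} (hf : ∀ t, HasDerivAt f (f' t) t)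
    (h : ∀ t, f' t ≤ K * f t) {a t : ℝ} (hat : a ≤ t) :
    f t ≤ f a * Real.exp (K * (t - a)) := by
  have hd : ∀ t, HasDerivAt (fun t => f t * Real.exp (-K * t))
      ((f' t - K * f t) * Real.exp (-K * t)) t := by
    intro t
    have h1 : HasDerivAt (fun t : ℝ => -K * t) (-K) t := by
      simpa using (hasDerivAt_id t).const_mul (-K)
    exact ((hf t).mul h1.exp).congr_deriv (by ring)
  have hanti : Antitone (fun t => f t * Real.exp (-K * t)) :=
    antitone_of_deriv_nonpos (fun t => (hd t).differentiableAt) fun t => by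
      rw [(hd t).deriv]
      exact mul_nonpos_of_nonpos_of_nonneg (by linarith [h t]) (Real.exp_pos _).le
  have h2 : f t * Real.exp (-K * t) ≤ f a * Real.exp (-K * a) := hanti hat
  calc f t = f t * Real.exp (-K * t) * Real.exp (K * t) := by
        rw [mul_assoc, ← Real.exp_add]; simp
    _ ≤ f a * Real.exp (-K * a) * Real.exp (K * t) := by gcongr
    _ = f a * Real.exp (K * (t - a)) := by
        rw [mul_assoc, ← Real.exp_add]; congr 2; ring

end Gronwall

section Rotation

theorem sqrt_norm_add_sq_le {V : Type*} [NormedAddCommGroup V] (u v w : V) :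
    √(‖u + w‖ ^ 2 + ‖v‖ ^ 2) ≤ √(‖u‖ ^ 2 + ‖v‖ ^ 2) + ‖w‖ := by
  have h1 : ‖u‖ ≤ √(‖u‖ ^ 2 + ‖v‖ ^ 2) := Real.le_sqrt_of_sq_le (by nlinarith [sq_nonneg ‖v‖])
  have h2 := Real.sq_sqrt (show 0 ≤ ‖u‖ ^ 2 + ‖v‖ ^ 2 by positivity)
  rw [Real.sqrt_le_left (by positivity)]
  have h3 := norm_add_le u w
  have h4 : ‖u + w‖ ^ 2 ≤ (‖u‖ + ‖w‖) ^ 2 := by gcongr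
  nlinarith [norm_nonneg w]

variable {V : Type*} [NormedAddCommGroup V] [InnerProductSpace ℝ V]

theorem norm_sq_rotation {c s : ℝ} (hcs : c ^ 2 + s ^ 2 = 1) (u v : V) :
    ‖(c ^ 2 - s ^ 2) • u + (2 * s * c) • v‖ ^ 2 + ‖-(2 * s * c) • u + (c ^ 2 - s ^ 2) • v‖ ^ 2
      = ‖u‖ ^ 2 + ‖v‖ ^ 2 := by
  rw [norm_add_sq_real, norm_add_sq_real]
  simp only [norm_smul, inner_smul_left, inner_smul_right, mul_pow, Real.norm_eq_abs, sq_abs,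
    conj_trivial]
  linear_combination (c ^ 2 + s ^ 2 + 1) * (‖u‖ ^ 2 + ‖v‖ ^ 2) * hcs

end Rotation

section Scheme

variable {V : Type*} [NormedAddCommGroup V] [InnerProductSpace ℝ V]

/-- The splitting scheme split into its non-oscillatory variables `(x, y)` and its oscillatory
variables `(X, Y)`; `β n` is the staggered magnetic field at time `n - 1/2`. -/
structure IsSplitting (A B D : V →L[ℝ] V) (τ c s φ ψ : ℝ) (x y X Y β : ℕ → V) : Prop where
  β_succ : ∀ n, β (n + 1) = β n - τ • D (y n + φ • Y n)
  x_succ : ∀ n, x (n + 1) = x n + τ • (y n + (τ / 2) • A (β (n + 1)))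
  y_succ : ∀ n, y (n + 1) = y n + τ • A (β (n + 1))
  X_succ : ∀ n, X (n + 1) = (c ^ 2 - s ^ 2) • X n
    + (2 * s * c) • (Y n + (τ / 2 * ψ) • B (β (n + 1)))
  Y_succ : ∀ n, Y (n + 1) = -(2 * s * c) • X n
    + (c ^ 2 - s ^ 2) • (Y n + (τ / 2 * ψ) • B (β (n + 1))) + (τ / 2 * ψ) • B (β (n + 1))

namespace IsSplitting

variable {A B D : V →L[ℝ] V} {τ c s φ ψ : ℝ} {x y X Y β : ℕ → V}

/-- Subtracting the equilibrium `τ k B β` turns the oscillatory step into a rotation. -/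
theorem energy_succ (h : IsSplitting A B D τ c s φ ψ x y X Y β) (hcs : c ^ 2 + s ^ 2 = 1) {k : ℝ}
    (hk : ψ * c = 2 * k * s) (n : ℕ) :
    ‖X (n + 1) - (τ * k) • B (β (n + 1))‖ ^ 2 + ‖Y (n + 1)‖ ^ 2
      = ‖X n - (τ * k) • B (β (n + 1))‖ ^ 2 + ‖Y n‖ ^ 2 := by
  rw [← norm_sq_rotation hcs (X n - (τ * k) • B (β (n + 1))) (Y n)]
  congr 3
  · rw [h.X_succ]
    match_scalars <;> first | ring1 | linear_combination τ * s * hk + τ * k * hcs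
  · rw [h.Y_succ]
    match_scalars
    · ring
    · ring
    · linear_combination τ * c * hk - τ * ψ / 2 * hcs

theorem norm_β_succ_sub_le (h : IsSplitting A B D τ c s φ ψ x y X Y β) (hτ : 0 ≤ τ)
    {M Φ : ℝ} (hM : 0 ≤ M) (hD : ∀ v, ‖D v‖ ≤ M * ‖v‖) (hΦ : 1 ≤ Φ) (hφ : |φ| ≤ Φ) (n : ℕ) :
    ‖β (n + 1) - β n‖ ≤ τ * (M * Φ * (‖y n‖ + ‖Y n‖)) := by
  have h1 : β (n + 1) - β n = -(τ • D (y n + φ • Y n)) := by rw [h.β_succ]; abel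
  rw [h1, norm_neg, norm_smul, Real.norm_of_nonneg hτ, mul_assoc M]
  gcongr
  refine (hD _).trans ?_
  gcongr
  refine (norm_add_le _ _).trans ?_
  rw [norm_smul, Real.norm_eq_abs, mul_add]
  gcongr
  exact le_mul_of_one_le_left (norm_nonneg _) hΦ

theorem sqrt_energy_succ_le (h : IsSplitting A B D τ c s φ ψ x y X Y β)
    (hcs : c ^ 2 + s ^ 2 = 1) {k : ℝ} (hk : ψ * c = 2 * k * s) (hτ : 0 ≤ τ)
    {M Φ κ : ℝ} (hM : 0 ≤ M) (hB : ∀ v, ‖B v‖ ≤ M * ‖v‖) (hD : ∀ v, ‖D v‖ ≤ M * ‖v‖)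
    (hΦ : 1 ≤ Φ) (hφ : |φ| ≤ Φ) (hκ : |k| ≤ κ) (n : ℕ) :
    √(‖X (n + 1) - (τ * k) • B (β (n + 1))‖ ^ 2 + ‖Y (n + 1)‖ ^ 2)
      ≤ √(‖X n - (τ * k) • B (β n)‖ ^ 2 + ‖Y n‖ ^ 2)
        + τ ^ 2 * (κ * M ^ 2 * Φ * (‖y n‖ + ‖Y n‖)) := by
  have hκ0 : 0 ≤ κ := (abs_nonneg k).trans hκ
  rw [h.energy_succ hcs hk]
  have h1 : X n - (τ * k) • B (β (n + 1))
      = X n - (τ * k) • B (β n) + -((τ * k) • B (β (n + 1) - β n)) := by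
    rw [map_sub, smul_sub]; abel
  rw [h1]
  refine (sqrt_norm_add_sq_le _ _ _).trans ?_
  gcongr
  rw [norm_neg, norm_smul, Real.norm_eq_abs, abs_mul, abs_of_nonneg hτ]
  calc τ * |k| * ‖B (β (n + 1) - β n)‖
      ≤ τ * κ * (M * (τ * (M * Φ * (‖y n‖ + ‖Y n‖)))) := by
        gcongr
        refine (hB _).trans ?_
        gcongr
        exact h.norm_β_succ_sub_le hτ hM hD hΦ hφ n
    _ = _ := by ring

theorem growth (h : IsSplitting A B D τ c s φ ψ x y X Y β)
    (hcs : c ^ 2 + s ^ 2 = 1) {k : ℝ} (hk : ψ * c = 2 * k * s) (hτ : 0 ≤ τ) (hτ1 : τ ≤ 1)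
    {M Φ κ : ℝ} (hM : 0 ≤ M) (hA : ∀ v, ‖A v‖ ≤ M * ‖v‖) (hB : ∀ v, ‖B v‖ ≤ M * ‖v‖)
    (hD : ∀ v, ‖D v‖ ≤ M * ‖v‖) (hΦ : 1 ≤ Φ) (hφ : |φ| ≤ Φ) (hκ : |k| ≤ κ) (n : ℕ) :
    ‖y n‖ + ‖β n‖ + √(‖X n - (τ * k) • B (β n)‖ ^ 2 + ‖Y n‖ ^ 2)
      ≤ Real.exp (n * (τ * (M + M * Φ + M ^ 2 * Φ + κ * M ^ 2 * Φ)))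
        * (‖y 0‖ + ‖β 0‖ + √(‖X 0 - (τ * k) • B (β 0)‖ ^ 2 + ‖Y 0‖ ^ 2)) := by
  have hκ0 : 0 ≤ κ := (abs_nonneg k).trans hκ
  have := discrete_gronwall_le
    (a := fun n => ‖y n‖ + ‖β n‖ + √(‖X n - (τ * k) • B (β n)‖ ^ 2 + ‖Y n‖ ^ 2))
    (δ := τ * (M + M * Φ + M ^ 2 * Φ + κ * M ^ 2 * Φ)) (L := 0) (by positivity) le_rfl
    (by positivity) n ?_ n le_rfl
  · simpa using this
  intro m _
  have h1 := h.sqrt_energy_succ_le hcs hk hτ hM hB hD hΦ hφ hκ m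
  have h2 := h.norm_β_succ_sub_le hτ hM hD hΦ hφ m
  have h3 : ‖Y m‖ ≤ √(‖X m - (τ * k) • B (β m)‖ ^ 2 + ‖Y m‖ ^ 2) :=
    Real.le_sqrt_of_sq_le (by nlinarith [sq_nonneg ‖X m - (τ * k) • B (β m)‖])
  set E := √(‖X m - (τ * k) • B (β m)‖ ^ 2 + ‖Y m‖ ^ 2)
  have h4 : ‖β (m + 1)‖ ≤ ‖β m‖ + τ * (M * Φ * (‖y m‖ + ‖Y m‖)) := by
    have := norm_add_le (β m) (β (m + 1) - β m)
    rw [add_sub_cancel] at this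
    linarith
  have h5 : ‖y (m + 1)‖ ≤ ‖y m‖ + τ * (M * ‖β (m + 1)‖) := by
    rw [h.y_succ]
    refine (norm_add_le _ _).trans ?_
    rw [norm_smul, Real.norm_of_nonneg hτ]
    gcongr
    exact hA _
  have hτ2 : τ ^ 2 ≤ τ := by nlinarith
  have hyE : ‖y m‖ + ‖Y m‖ ≤ ‖y m‖ + ‖β m‖ + E := by linarith [norm_nonneg (β m)]
  set a := ‖y m‖ + ‖β m‖ + E with ha
  have h6 : τ * (M * Φ * (‖y m‖ + ‖Y m‖)) ≤ τ * (M * Φ * a) := by gcongr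
  have h7 : τ ^ 2 * (κ * M ^ 2 * Φ * (‖y m‖ + ‖Y m‖)) ≤ τ * (κ * M ^ 2 * Φ * a) := by gcongr
  have h8 : τ * (M * ‖β (m + 1)‖) ≤ τ * (M * a) + τ * (M ^ 2 * Φ * a) := by
    calc τ * (M * ‖β (m + 1)‖) ≤ τ * (M * (a + τ * (M * Φ * a))) := by
          gcongr
          linarith [norm_nonneg (y m), norm_nonneg (Y m)]
      _ = τ * (M * a) + τ ^ 2 * (M ^ 2 * Φ * a) := by ring
      _ ≤ _ := by gcongr
  linarith

/-- The oscillatory part of the numerical solution is of size `τ`. -/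
theorem exists_bound (S M Φ κ R : ℝ) (hS : 0 ≤ S) (hM : 0 ≤ M) (hΦ : 1 ≤ Φ) (hκ : 0 ≤ κ)
    (hR : 0 ≤ R) : ∃ C : ℝ, 0 ≤ C ∧ ∀ (V : Type) [NormedAddCommGroup V] [InnerProductSpace ℝ V]
      (A B D : V →L[ℝ] V) (τ c s φ ψ k : ℝ) (x y X Y β : ℕ → V),
      IsSplitting A B D τ c s φ ψ x y X Y β → c ^ 2 + s ^ 2 = 1 → ψ * c = 2 * k * s →
      0 ≤ τ → τ ≤ 1 → (∀ v, ‖A v‖ ≤ M * ‖v‖) → (∀ v, ‖B v‖ ≤ M * ‖v‖) →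
      (∀ v, ‖D v‖ ≤ M * ‖v‖) → |φ| ≤ Φ → |k| ≤ κ →
      ‖y 0‖ ≤ R → ‖β 0‖ ≤ R → ‖X 0‖ ≤ R * τ → ‖Y 0‖ ≤ R * τ →
      ∀ n : ℕ, n * τ ≤ S → ‖X n‖ ≤ C * τ ∧ ‖Y n‖ ≤ C * τ ∧ ‖y n‖ ≤ C := by
  set K := M + M * Φ + M ^ 2 * Φ + κ * M ^ 2 * Φ with hK
  have hK0 : 0 ≤ K := by positivity
  set R' := R + κ * (M * R) + R with hR'
  have hR'0 : 0 ≤ R' := by positivity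
  set G := Real.exp (S * K) * (R + R + R') with hG
  have hG0 : 0 ≤ G := by positivity
  refine ⟨R' + S * (κ * M ^ 2 * Φ * G) + κ * (M * G) + G, by positivity, ?_⟩
  intro V _ _ A B D τ c s φ ψ k x y X Y β h hcs hk hτ hτ1 hA hB hD hφ hkκ hy0 hβ0 hX0 hY0 n hn
  have hE0 : √(‖X 0 - (τ * k) • B (β 0)‖ ^ 2 + ‖Y 0‖ ^ 2) ≤ R' * τ := by
    have h1 : ‖X 0 - (τ * k) • B (β 0)‖ ≤ R * τ + κ * (M * R) * τ := by
      refine (norm_sub_le _ _).trans ?_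
      rw [norm_smul, Real.norm_eq_abs, abs_mul, abs_of_nonneg hτ]
      have : τ * |k| * ‖B (β 0)‖ ≤ τ * κ * (M * R) := by
        gcongr
        exact (hB _).trans (by gcongr)
      linarith
    rw [Real.sqrt_le_left (by positivity)]
    calc _ ≤ (R * τ + κ * (M * R) * τ) ^ 2 + (R * τ) ^ 2 := by gcongr
      _ ≤ (R * τ + κ * (M * R) * τ + R * τ) ^ 2 := by
        have h2 : 0 ≤ (R * τ + κ * (M * R) * τ) * (R * τ) := by positivity
        nlinarith
      _ = _ := by rw [hR']; ring
  have hG' : ∀ m : ℕ, m * τ ≤ S →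
      ‖y m‖ + ‖β m‖ + √(‖X m - (τ * k) • B (β m)‖ ^ 2 + ‖Y m‖ ^ 2) ≤ G := by
    intro m hm
    refine (h.growth hcs hk hτ hτ1 hM hA hB hD hΦ hφ hkκ m).trans ?_
    rw [hG, ← mul_assoc (m : ℝ)]
    have : R' * τ ≤ R' := mul_le_of_le_one_right hR'0 hτ1
    gcongr
    linarith
  have hYE : ∀ m, ‖Y m‖ ≤ √(‖X m - (τ * k) • B (β m)‖ ^ 2 + ‖Y m‖ ^ 2) := fun m =>
    Real.le_sqrt_of_sq_le (by nlinarith [sq_nonneg ‖X m - (τ * k) • B (β m)‖])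
  have hE : ∀ m : ℕ, m * τ ≤ S → √(‖X m - (τ * k) • B (β m)‖ ^ 2 + ‖Y m‖ ^ 2)
      ≤ R' * τ + m * (τ ^ 2 * (κ * M ^ 2 * Φ * G)) := by
    intro m
    induction m with
    | zero => intro _; simpa using hE0
    | succ m ih =>
      intro hm
      have hm' : m * τ ≤ S := by push_cast at hm; linarith
      have h1 := ih hm'
      have h2 := h.sqrt_energy_succ_le hcs hk hτ hM hB hD hΦ hφ hkκ m
      have h3 : τ ^ 2 * (κ * M ^ 2 * Φ * (‖y m‖ + ‖Y m‖)) ≤ τ ^ 2 * (κ * M ^ 2 * Φ * G) := by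
        gcongr
        linarith [hG' m hm', hYE m, norm_nonneg (β m)]
      push_cast
      linarith
  have hEn : √(‖X n - (τ * k) • B (β n)‖ ^ 2 + ‖Y n‖ ^ 2)
      ≤ (R' + S * (κ * M ^ 2 * Φ * G)) * τ := by
    refine (hE n hn).trans ?_
    have : n * τ * (τ * (κ * M ^ 2 * Φ * G)) ≤ S * (τ * (κ * M ^ 2 * Φ * G)) := by gcongr
    linarith
  have hXE : ‖X n - (τ * k) • B (β n)‖ ≤ √(‖X n - (τ * k) • B (β n)‖ ^ 2 + ‖Y n‖ ^ 2) :=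
    Real.le_sqrt_of_sq_le (by nlinarith [sq_nonneg ‖Y n‖])
  have hGn := hG' n hn
  have hβn : ‖β n‖ ≤ G := by linarith [norm_nonneg (y n), norm_nonneg (Y n), hYE n]
  have hyn : ‖y n‖ ≤ G := by linarith [norm_nonneg (β n), norm_nonneg (Y n), hYE n]
  have hkB : ‖(τ * k) • B (β n)‖ ≤ τ * κ * (M * G) := by
    rw [norm_smul, Real.norm_eq_abs, abs_mul, abs_of_nonneg hτ]
    gcongr
    exact (hB _).trans (by gcongr)
  have hX : ‖X n‖ ≤ ‖X n - (τ * k) • B (β n)‖ + ‖(τ * k) • B (β n)‖ := by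
    simpa using norm_add_le (X n - (τ * k) • B (β n)) ((τ * k) • B (β n))
  have hp1 : 0 ≤ κ * (M * G) * τ := by positivity
  have hp2 : 0 ≤ G * τ := by positivity
  have hp3 : 0 ≤ R' + S * (κ * M ^ 2 * Φ * G) + κ * (M * G) := by positivity
  refine ⟨by linarith, by linarith [hYE n], by linarith⟩

theorem x_succ_sub (h : IsSplitting A B D τ c s φ ψ x y X Y β) (n : ℕ) :
    x (n + 1) - x n = (τ / 2) • (y n + y (n + 1)) := by
  rw [h.x_succ, h.y_succ]
  module

theorem smul_X_succ_sub (h : IsSplitting A B D τ c s φ ψ x y X Y β) {q ι : ℝ}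
    (hcs : c ^ 2 + s ^ 2 = 1) (hq : τ / 2 * φ = q * s * ι) (n : ℕ) :
    (q * c * ι) • (X (n + 1) - X n) = (τ / 2 * φ) • (Y n + Y (n + 1)) := by
  rw [h.X_succ, h.Y_succ, hq]
  obtain rfl | hs := eq_or_ne s 0
  · have hc : c ^ 2 = 1 := by linarith
    simp [hc]
  have h1 : c ^ 2 - s ^ 2 = 1 - 2 * s ^ 2 := by linarith
  have h2 : c ^ 2 = 1 - s ^ 2 := by linarith
  rw [h1]
  match_scalars
  · ring
  · linear_combination (q * ι * 2 * s) * h2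
  · linear_combination (q * ι * s * τ * ψ) * h2

/-- The discrete magnetic field is an affine function of the impulses. -/
theorem β_succ_add (h : IsSplitting A B D τ c s φ ψ x y X Y β) {q ι : ℝ}
    (hcs : c ^ 2 + s ^ 2 = 1) (hq : τ / 2 * φ = q * s * ι) (n : ℕ) :
    β (n + 1) + (τ / 2) • D (y n + φ • Y n)
      = β 1 + (τ / 2) • D (y 0 + φ • Y 0) + D (x 0 - x n) + D ((q * c * ι) • (X 0 - X n)) := by
  induction n with
  | zero => simp
  | succ n ih =>
    have h1 : β (n + 2) + (τ / 2) • D (y (n + 1) + φ • Y (n + 1))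
        = β (n + 1) + (τ / 2) • D (y n + φ • Y n) - D (x (n + 1) - x n)
          - D ((q * c * ι) • (X (n + 1) - X n)) := by
      rw [h.β_succ (n + 1), h.x_succ_sub, h.smul_X_succ_sub hcs hq]
      simp only [map_add, map_smul]
      module
    rw [h1, ih]
    simp only [map_sub, map_smul]
    module

theorem norm_A_β_succ_sub_le (h : IsSplitting A B D τ c s φ ψ x y X Y β) {q ι : ℝ}
    (hcs : c ^ 2 + s ^ 2 = 1) (hq : τ / 2 * φ = q * s * ι) (hτ : 0 ≤ τ)
    {M Φ G γ : ℝ} (hM : 0 ≤ M) (hA : ∀ v, ‖A v‖ ≤ M * ‖v‖) (hD : ∀ v, ‖D v‖ ≤ M * ‖v‖)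
    (hφ : |φ| ≤ Φ) (hqΦ : |q| ≤ Φ) (hι : 0 ≤ ι) (hιτ : ι ≤ γ * τ) (hG : 0 ≤ G)
    {n : ℕ} (hX0 : ‖X 0‖ ≤ G * τ) (hX : ‖X n‖ ≤ G * τ) (hY : ‖Y n‖ ≤ G * τ) :
    ‖A (β (n + 1)) - A (β 1 + (τ / 2) • D (y 0 + φ • Y 0) + D (x 0 - x n))
      + (τ / 2) • A (D (y n))‖ ≤ M ^ 2 * (Φ * G * (1 + 2 * γ)) * τ ^ 2 := by
  have hΦ : 0 ≤ Φ := (abs_nonneg _).trans hφ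
  have h1 := h.β_succ_add hcs hq n
  have h2 : A (β (n + 1)) - A (β 1 + (τ / 2) • D (y 0 + φ • Y 0) + D (x 0 - x n))
      + (τ / 2) • A (D (y n)) = A (D ((q * c * ι) • (X 0 - X n) - (τ / 2 * φ) • Y n)) := by
    rw [eq_sub_of_add_eq h1]
    simp only [map_add, map_sub, map_smul]
    module
  rw [h2]
  have hc : |c| ≤ 1 := abs_le_one_iff_mul_self_le_one.2 (by nlinarith)
  have h3 : ‖(q * c * ι) • (X 0 - X n) - (τ / 2 * φ) • Y n‖ ≤ Φ * G * (1 + 2 * γ) * τ ^ 2 := by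
    refine (norm_sub_le _ _).trans ?_
    rw [norm_smul, norm_smul, Real.norm_eq_abs, Real.norm_eq_abs, abs_mul, abs_mul, abs_mul,
      abs_of_nonneg hι, abs_of_nonneg (by positivity : 0 ≤ τ / 2)]
    have h4 : ‖X 0 - X n‖ ≤ G * τ + G * τ := (norm_sub_le _ _).trans (by gcongr)
    have hγ : 0 ≤ γ * τ := hι.trans hιτ
    have h5 : |q| * |c| * ι * ‖X 0 - X n‖ ≤ Φ * 1 * (γ * τ) * (G * τ + G * τ) := by gcongr
    have h6 : τ / 2 * |φ| * ‖Y n‖ ≤ τ / 2 * Φ * (G * τ) := by gcongr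
    have h7 : 0 ≤ Φ * G * τ ^ 2 := by positivity
    nlinarith
  calc _ ≤ M * (M * (Φ * G * (1 + 2 * γ) * τ ^ 2)) := by
        refine (hA _).trans ?_
        gcongr
        refine (hD _).trans ?_
        gcongr
    _ = _ := by ring

end IsSplitting

end Scheme

section Flow

theorem norm_sub_le_of_hasDerivAt {V : Type*} [NormedAddCommGroup V] [NormedSpace ℝ V]
    {g g' : ℝ → V} {C a τ : ℝ} (hC : 0 ≤ C)
    (hg : ∀ s, HasDerivAt g (g' s) s) (hb : ∀ s ∈ Set.Icc a (a + τ), ‖g' s‖ ≤ C) :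
    ∀ s ∈ Set.Icc a (a + τ), ‖g s - g a‖ ≤ C * τ := by
  intro s hs
  refine (norm_image_sub_le_of_norm_deriv_le_segment' (fun r _ => (hg r).hasDerivWithinAt)
    (fun r hr => hb r (Set.Ico_subset_Icc_self hr)) s hs).trans ?_
  gcongr
  linarith [hs.2]

variable {V : Type*} [NormedAddCommGroup V] [InnerProductSpace ℝ V]

/-- The semidiscrete Maxwell system split into its non-oscillatory variables `(x, y)` and its
rescaled oscillatory variables `(X, Y)`. -/
structure IsFlow (A B D : V →L[ℝ] V) (ω : ℝ) (x y X Y b : ℝ → V) : Prop where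
  hasDerivAt_x : ∀ t, HasDerivAt x (y t) t
  hasDerivAt_y : ∀ t, HasDerivAt y (A (b t)) t
  hasDerivAt_X : ∀ t, HasDerivAt X (ω • Y t) t
  hasDerivAt_Y : ∀ t, HasDerivAt Y (B (b t) - ω • X t) t
  hasDerivAt_b : ∀ t, HasDerivAt b (-D (y t + Y t)) t

theorem abs_inner_le_of_norm_le {M : ℝ} {v u : V} {r : ℝ} (hM : 0 ≤ M) (hv : ‖v‖ ≤ M * r) :
    2 * |inner ℝ u v| ≤ M * (‖u‖ ^ 2 + r ^ 2) := by
  have h1 := abs_real_inner_le_norm u v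
  have h2 : ‖u‖ * ‖v‖ ≤ ‖u‖ * (M * r) := by gcongr
  nlinarith [mul_nonneg hM (sq_nonneg (‖u‖ - r))]

namespace IsFlow

variable {A B D : V →L[ℝ] V} {ω : ℝ} {x y X Y b : ℝ → V}

theorem growth (h : IsFlow A B D ω x y X Y b) {M : ℝ} (hM : 0 ≤ M)
    (hA : ∀ v, ‖A v‖ ≤ M * ‖v‖) (hB : ∀ v, ‖B v‖ ≤ M * ‖v‖) (hD : ∀ v, ‖D v‖ ≤ M * ‖v‖)
    {a t : ℝ} (hat : a ≤ t) :
    ‖ω • X t - B (b t)‖ ^ 2 + ‖ω • Y t‖ ^ 2 + ‖y t‖ ^ 2 + ‖b t‖ ^ 2 + ‖X t‖ ^ 2 + ‖Y t‖ ^ 2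
      ≤ (‖ω • X a - B (b a)‖ ^ 2 + ‖ω • Y a‖ ^ 2 + ‖y a‖ ^ 2 + ‖b a‖ ^ 2 + ‖X a‖ ^ 2
        + ‖Y a‖ ^ 2) * Real.exp ((3 * M ^ 2 + 6 * M) * (t - a)) := by
  have hd := fun t => ((((((((h.hasDerivAt_X t).const_smul ω).sub
    (B.hasFDerivAt.comp_hasDerivAt t (h.hasDerivAt_b t))).norm_sq).add
    ((h.hasDerivAt_Y t).const_smul ω).norm_sq).add (h.hasDerivAt_y t).norm_sq).add
    (h.hasDerivAt_b t).norm_sq).add (h.hasDerivAt_X t).norm_sq).add (h.hasDerivAt_Y t).norm_sq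
  refine le_mul_exp_of_deriv_le hd (fun t => ?_) hat
  simp only [Pi.smul_apply, Pi.sub_apply, Function.comp_apply, Pi.add_apply]
  have e1 : inner ℝ (ω • X t - B (b t)) (ω • ω • Y t - B (-D (y t + Y t)))
      + inner ℝ (ω • Y t) (ω • (B (b t) - ω • X t))
      = inner ℝ (ω • X t - B (b t)) (B (D (y t + Y t))) := by
    simp only [map_neg, sub_neg_eq_add, inner_add_right, inner_sub_left, inner_sub_right,
      inner_smul_left, inner_smul_right, conj_trivial, smul_sub]
    rw [real_inner_comm (Y t) (X t), real_inner_comm (Y t) (B (b t))]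
    ring
  have e2 : inner ℝ (X t) (ω • Y t) + inner ℝ (Y t) (B (b t) - ω • X t)
      = inner ℝ (Y t) (B (b t)) := by
    simp only [inner_sub_right, inner_smul_right, real_inner_comm (Y t) (X t)]
    ring
  have hDy : ‖D (y t + Y t)‖ ≤ M * (‖y t‖ + ‖Y t‖) :=
    (hD _).trans (by gcongr; exact norm_add_le _ _)
  have hBD : ‖B (D (y t + Y t))‖ ≤ M ^ 2 * (‖y t‖ + ‖Y t‖) := by
    refine (hB _).trans ?_
    rw [pow_two, mul_assoc]
    gcongr
  have i1 := abs_inner_le_of_norm_le (u := ω • X t - B (b t)) (by positivity) hBD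
  have i2 := abs_inner_le_of_norm_le (u := y t) hM (hA (b t))
  have i3 := abs_inner_le_of_norm_le (u := b t) hM hDy
  have i4 := abs_inner_le_of_norm_le (u := Y t) hM (hB (b t))
  have hs : (‖y t‖ + ‖Y t‖) ^ 2 ≤ 2 * ‖y t‖ ^ 2 + 2 * ‖Y t‖ ^ 2 := by
    nlinarith [sq_nonneg (‖y t‖ - ‖Y t‖)]
  have j1 := mul_le_mul_of_nonneg_left hs (sq_nonneg M)
  have j2 := mul_le_mul_of_nonneg_left hs hM
  have k1 := le_abs_self (inner ℝ (ω • X t - B (b t)) (B (D (y t + Y t))))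
  have k2 := le_abs_self (inner ℝ (y t) (A (b t)))
  have k3 := neg_abs_le (inner ℝ (b t) (D (y t + Y t)))
  have k4 := le_abs_self (inner ℝ (Y t) (B (b t)))
  rw [inner_neg_right]
  have hM2 := sq_nonneg M
  set n1 := ‖ω • X t - B (b t)‖ ^ 2
  set n2 := ‖ω • Y t‖ ^ 2
  have hn1 : 0 ≤ n1 := sq_nonneg _
  have hn2 : 0 ≤ n2 := sq_nonneg _
  have l1 := mul_nonneg hM hn1
  have l2 := mul_nonneg hM hn2
  have l3 := mul_nonneg hM2 hn1
  have l4 := mul_nonneg hM2 hn2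
  have l5 := mul_nonneg hM (sq_nonneg ‖y t‖)
  have l6 := mul_nonneg hM (sq_nonneg ‖Y t‖)
  have l7 := mul_nonneg hM (sq_nonneg ‖b t‖)
  have l8 := mul_nonneg hM (sq_nonneg ‖X t‖)
  have l9 := mul_nonneg hM2 (sq_nonneg ‖y t‖)
  have l10 := mul_nonneg hM2 (sq_nonneg ‖Y t‖)
  have l11 := mul_nonneg hM2 (sq_nonneg ‖b t‖)
  have l12 := mul_nonneg hM2 (sq_nonneg ‖X t‖)
  linarith

theorem b_eq (h : IsFlow A B D ω x y X Y b) (hω : ω ≠ 0) (a t : ℝ) :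
    b t = b a + D (x a - x t) + D (ω⁻¹ • (X a - X t)) := by
  have hd : ∀ t, HasDerivAt (fun t => b t + D (x t) + D (ω⁻¹ • X t)) 0 t := fun t => by
    refine (((h.hasDerivAt_b t).add (D.hasFDerivAt.comp_hasDerivAt t (h.hasDerivAt_x t))).add
      (D.hasFDerivAt.comp_hasDerivAt t ((h.hasDerivAt_X t).const_smul ω⁻¹))).congr_deriv ?_
    rw [smul_smul, inv_mul_cancel₀ hω, one_smul, map_add]
    abel
  have h1 := is_const_of_deriv_eq_zero (fun t => (hd t).differentiableAt)
    (fun t => (hd t).deriv) t a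
  simp only [map_smul, map_sub] at h1 ⊢
  rw [← sub_eq_zero] at h1 ⊢
  rw [← h1]
  module

/-- The oscillatory part of the exact solution is of size `1 / ω`. -/
theorem exists_bound (S M R : ℝ) (hM : 0 ≤ M) :
    ∃ C : ℝ, 0 ≤ C ∧ ∀ (V : Type) [NormedAddCommGroup V] [InnerProductSpace ℝ V]
      (A B D : V →L[ℝ] V) (ω : ℝ) (x y X Y b : ℝ → V), IsFlow A B D ω x y X Y b →
      (∀ v, ‖A v‖ ≤ M * ‖v‖) → (∀ v, ‖B v‖ ≤ M * ‖v‖) → (∀ v, ‖D v‖ ≤ M * ‖v‖) →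
      ∀ a : ℝ, ‖ω • X a‖ ≤ R → ‖ω • Y a‖ ≤ R → ‖y a‖ ≤ R → ‖b a‖ ≤ R → ‖X a‖ ≤ R → ‖Y a‖ ≤ R →
      ∀ t ∈ Set.Icc a (a + S), ‖ω • X t‖ ≤ C ∧ ‖y t‖ ≤ C ∧ ‖b t‖ ≤ C := by
  set G := ((R + M * R) ^ 2 + R ^ 2 + R ^ 2 + R ^ 2 + R ^ 2 + R ^ 2)
    * Real.exp ((3 * M ^ 2 + 6 * M) * S) with hG
  have hG0 : 0 ≤ G := by positivity
  refine ⟨√G + M * √G, by positivity, ?_⟩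
  intro V _ _ A B D ω x y X Y b h hA hB hD a hX hY hy hb hX' hY' t ht
  have h0 : ‖ω • X a - B (b a)‖ ≤ R + M * R :=
    (norm_sub_le _ _).trans (add_le_add hX ((hB _).trans (by gcongr)))
  have h1 := h.growth hM hA hB hD ht.1
  have h2 : ‖ω • X t - B (b t)‖ ^ 2 + ‖ω • Y t‖ ^ 2 + ‖y t‖ ^ 2 + ‖b t‖ ^ 2 + ‖X t‖ ^ 2
      + ‖Y t‖ ^ 2 ≤ G := by
    refine h1.trans ?_
    rw [hG]
    gcongr
    linarith [ht.2]
  have n1 := sq_nonneg ‖ω • X t - B (b t)‖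
  have n2 := sq_nonneg ‖ω • Y t‖
  have n3 := sq_nonneg ‖y t‖
  have n4 := sq_nonneg ‖b t‖
  have n5 := sq_nonneg ‖X t‖
  have n6 := sq_nonneg ‖Y t‖
  have m1 : ‖ω • X t - B (b t)‖ ≤ √G := Real.le_sqrt_of_sq_le (by linarith)
  have m2 : ‖y t‖ ≤ √G := Real.le_sqrt_of_sq_le (by linarith)
  have m3 : ‖b t‖ ≤ √G := Real.le_sqrt_of_sq_le (by linarith)
  have m4 : 0 ≤ M * √G := by positivity
  refine ⟨?_, by linarith, by linarith⟩
  calc ‖ω • X t‖ = ‖(ω • X t - B (b t)) + B (b t)‖ := by rw [sub_add_cancel]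
    _ ≤ √G + M * √G := (norm_add_le _ _).trans (add_le_add m1 ((hB _).trans (by gcongr)))

end IsFlow

theorem norm_comp_le {A D : V →L[ℝ] V} {M : ℝ} (hM : 0 ≤ M) (hA : ∀ v, ‖A v‖ ≤ M * ‖v‖)
    (hD : ∀ v, ‖D v‖ ≤ M * ‖v‖) (v : V) : ‖A (D v)‖ ≤ M ^ 2 * ‖v‖ := by
  rw [pow_two, mul_assoc]
  refine (hA _).trans ?_
  gcongr
  exact hD v

namespace IsFlow

variable {A B D : V →L[ℝ] V} {ω : ℝ} {x y X Y b : ℝ → V}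

/-- Local error of the non-oscillatory variables with respect to Taylor expansion in the
averaged force `z ↦ A (b a + D (x a - z))`. -/
theorem local_error (h : IsFlow A B D ω x y X Y b) {M G L τ a t : ℝ} (hM : 0 ≤ M)
    (hA : ∀ v, ‖A v‖ ≤ M * ‖v‖) (hD : ∀ v, ‖D v‖ ≤ M * ‖v‖) (hτ : 0 ≤ τ) (hτ1 : τ ≤ 1)
    (hG : 0 ≤ G) (hL : 0 ≤ L) (hy : ∀ s ∈ Set.Icc t (t + τ), ‖y s‖ ≤ G)
    (hb : ∀ s ∈ Set.Icc t (t + τ), ‖b s‖ ≤ G)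
    (hf : ∀ s ∈ Set.Icc t (t + τ), ‖A (b s) - A (b a + D (x a - x s))‖ ≤ L * τ ^ 2) :
    ‖x (t + τ) - x t - τ • y t - (τ ^ 2 / 2) • A (b a + D (x a - x t))‖
        ≤ (L + M ^ 2 * G + M ^ 3 * G) * τ ^ 3 ∧
      ‖y (t + τ) - y t - τ • A (b a + D (x a - x t)) + (τ ^ 2 / 2) • A (D (y t))‖
        ≤ (L + M ^ 2 * G + M ^ 3 * G) * τ ^ 3 := by
  have hid : ∀ s : ℝ, HasDerivAt (fun s : ℝ => s - t) 1 s := fun s =>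
    (hasDerivAt_id s).sub_const t
  have hsq : ∀ s : ℝ, HasDerivAt (fun s : ℝ => (s - t) ^ 2 / 2) (s - t) s := fun s =>
    (((hid s).pow 2).div_const 2).congr_deriv (by norm_num)
  have hend : t + τ ∈ Set.Icc t (t + τ) := ⟨by linarith, le_rfl⟩
  have hx1 := norm_sub_le_of_hasDerivAt hG h.hasDerivAt_x hy
  have hy1 := norm_sub_le_of_hasDerivAt (C := M * G) (by positivity) h.hasDerivAt_y
    (fun s hs => (hA _).trans (by gcongr; exact hb s hs))
  have hx2 := norm_sub_le_of_hasDerivAt (C := M * G * τ) (by positivity)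
    (fun s => ((h.hasDerivAt_x s).sub ((hid s).smul_const (y t))))
    (fun s hs => by simpa using hy1 s hs)
  set F := A (b a + D (x a - x t)) with hF
  have hAF : ∀ s, A (b s) - F
      = (A (b s) - A (b a + D (x a - x s))) - A (D (x s - x t)) := fun s => by
    rw [hF]
    simp only [map_add, map_sub]
    abel
  have hforce : ∀ s ∈ Set.Icc t (t + τ), ‖A (b s) - F‖ ≤ (L + M ^ 2 * G) * τ := by
    intro s hs
    rw [hAF]
    refine (norm_sub_le _ _).trans ?_
    have h1 := norm_comp_le hM hA hD (x s - x t)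
    have h2 : M ^ 2 * ‖x s - x t‖ ≤ M ^ 2 * (G * τ) := by gcongr; exact hx1 s hs
    have h3 : L * τ ^ 2 ≤ L * τ := by gcongr; nlinarith
    linarith [hf s hs]
  have hy2 := norm_sub_le_of_hasDerivAt (C := (L + M ^ 2 * G) * τ) (by positivity)
    (fun s => ((h.hasDerivAt_y s).sub ((hid s).smul_const F)))
    (fun s hs => by simpa using hforce s hs)
  have hx3 := norm_sub_le_of_hasDerivAt (C := (L + M ^ 2 * G) * τ * τ) (by positivity)
    (fun s => ((h.hasDerivAt_x s).sub ((hid s).smul_const (y t))).sub ((hsq s).smul_const F))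
    (fun s hs => by
      have := hy2 s hs
      simp only [Pi.sub_apply, sub_self, zero_smul, sub_zero] at this
      rw [one_smul]
      convert this using 2
      abel)
  have hy3 := norm_sub_le_of_hasDerivAt (C := (L + M ^ 3 * G) * τ ^ 2) (by positivity)
    (fun s => ((h.hasDerivAt_y s).sub ((hid s).smul_const F)).add
      ((hsq s).smul_const (A (D (y t)))))
    (fun s hs => by
      have h1 := hx2 s hs
      simp only [Pi.sub_apply, sub_self, zero_smul, sub_zero] at h1
      have h2 : A (b s) - (1 : ℝ) • F + (s - t) • A (D (y t))
          = (A (b s) - A (b a + D (x a - x s))) - A (D (x s - (s - t) • y t - x t)) := by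
        rw [one_smul, hAF]
        simp only [map_sub, map_smul]
        abel
      rw [h2]
      refine (norm_sub_le _ _).trans ?_
      have h3 := norm_comp_le hM hA hD (x s - (s - t) • y t - x t)
      have h4 : M ^ 2 * ‖x s - (s - t) • y t - x t‖ ≤ M ^ 2 * (M * G * τ * τ) := by gcongr
      linarith [hf s hs])
  have hx4 := hx3 _ hend
  have hy4 := hy3 _ hend
  simp only [Pi.sub_apply, Pi.add_apply, sub_self, zero_smul, sub_zero, add_zero,
    add_sub_cancel_left, ne_eq, OfNat.ofNat_ne_zero, not_false_eq_true, zero_pow, zero_div]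
    at hx4 hy4
  have p1 : 0 ≤ M ^ 3 * G * τ ^ 3 := by positivity
  have p2 : 0 ≤ M ^ 2 * G * τ ^ 3 := by positivity
  constructor
  · have e : x (t + τ) - x t - τ • y t - (τ ^ 2 / 2) • F
        = x (t + τ) - τ • y t - (τ ^ 2 / 2) • F - x t := by abel
    rw [e]
    linarith
  · have e : y (t + τ) - y t - τ • F + (τ ^ 2 / 2) • A (D (y t))
        = y (t + τ) - τ • F + (τ ^ 2 / 2) • A (D (y t)) - y t := by abel
    rw [e]
    linarith

end IsFlow

end Flow

section Convergence

variable {V : Type*} [NormedAddCommGroup V] [InnerProductSpace ℝ V]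

/-- One step of error propagation for the non-oscillatory variables; `F` and `f` are the averaged
forces at the numerical and exact impulses. -/
theorem error_step {A D : V →L[ℝ] V} {M G L L' τ : ℝ} (hM : 0 ≤ M)
    (hA : ∀ v, ‖A v‖ ≤ M * ‖v‖) (hD : ∀ v, ‖D v‖ ≤ M * ‖v‖) (hτ : 0 ≤ τ) (hτ1 : τ ≤ 1)
    (hL : 0 ≤ L) {x x' y y' w u u' v v' F f : V} (hFf : F - f = -A (D (x - u)))
    (hx : x' = x + τ • (y + (τ / 2) • w)) (hy : y' = y + τ • w) (hyG : ‖y‖ ≤ G)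
    (hw : ‖w - F + (τ / 2) • A (D y)‖ ≤ L * τ ^ 2)
    (hu : ‖u' - u - τ • v - (τ ^ 2 / 2) • f‖ ≤ L' * τ ^ 3)
    (hv : ‖v' - v - τ • f + (τ ^ 2 / 2) • A (D v)‖ ≤ L' * τ ^ 3) :
    ‖x' - u'‖ + ‖y' - v'‖ ≤ (1 + τ * (1 + 2 * M ^ 2)) * (‖x - u‖ + ‖y - v‖)
      + (2 * L + M ^ 2 * G + 2 * L') * τ ^ 3 := by
  have hτ2 : τ ^ 2 ≤ τ := by nlinarith
  have hτ3 : τ ^ 3 ≤ τ ^ 2 := by nlinarith [sq_nonneg τ]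
  have hADy := norm_comp_le hM hA hD y
  have hADx := norm_comp_le hM hA hD (x - u)
  have hADε := norm_comp_le hM hA hD (y - v)
  have e1 : x' - u' = (x - u) + τ • (y - v) + (τ ^ 2 / 2) • (w - F + (τ / 2) • A (D y))
      - (τ ^ 3 / 4) • A (D y) - (τ ^ 2 / 2) • A (D (x - u))
      - (u' - u - τ • v - (τ ^ 2 / 2) • f) := by
    rw [← neg_eq_iff_eq_neg.2 hFf, hx]
    module
  have e2 : y' - v' = (y - v) - τ • A (D (x - u)) - (τ ^ 2 / 2) • A (D (y - v))
      + τ • (w - F + (τ / 2) • A (D y))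
      - (v' - v - τ • f + (τ ^ 2 / 2) • A (D v)) := by
    rw [← neg_eq_iff_eq_neg.2 hFf, hy]
    simp only [map_sub]
    module
  have b1 : ‖x' - u'‖ ≤ ‖x - u‖ + τ * ‖y - v‖ + (τ ^ 2 / 2) * (L * τ ^ 2)
      + (τ ^ 3 / 4) * (M ^ 2 * G) + (τ ^ 2 / 2) * (M ^ 2 * ‖x - u‖) + L' * τ ^ 3 := by
    rw [e1]
    refine (norm_sub_le _ _).trans (add_le_add ?_ hu)
    refine (norm_sub_le _ _).trans (add_le_add ?_ ?_)
    · refine (norm_sub_le _ _).trans (add_le_add ?_ ?_)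
      · refine (norm_add_le _ _).trans (add_le_add ((norm_add_le _ _).trans ?_) ?_)
        · rw [norm_smul, Real.norm_of_nonneg hτ]
        · rw [norm_smul, Real.norm_of_nonneg (by positivity)]
          gcongr
      · rw [norm_smul, Real.norm_of_nonneg (by positivity)]
        gcongr
        exact hADy.trans (by gcongr)
    · rw [norm_smul, Real.norm_of_nonneg (by positivity)]
      gcongr
  have b2 : ‖y' - v'‖ ≤ ‖y - v‖ + τ * (M ^ 2 * ‖x - u‖) + (τ ^ 2 / 2) * (M ^ 2 * ‖y - v‖)
      + τ * (L * τ ^ 2) + L' * τ ^ 3 := by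
    rw [e2]
    refine (norm_sub_le _ _).trans (add_le_add ?_ hv)
    refine (norm_add_le _ _).trans (add_le_add ?_ ?_)
    · refine (norm_sub_le _ _).trans (add_le_add ((norm_sub_le _ _).trans ?_) ?_)
      · rw [norm_smul, Real.norm_of_nonneg hτ]
        gcongr
      · rw [norm_smul, Real.norm_of_nonneg (by positivity)]
        gcongr
    · rw [norm_smul, Real.norm_of_nonneg hτ]
      gcongr
  have hG : 0 ≤ G := (norm_nonneg _).trans hyG
  have c1 : τ ^ 2 * (M ^ 2 * ‖x - u‖) ≤ τ * (M ^ 2 * ‖x - u‖) := by gcongr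
  have c2 : τ ^ 2 * (M ^ 2 * ‖y - v‖) ≤ τ * (M ^ 2 * ‖y - v‖) := by gcongr
  have c3 : L * τ ^ 4 ≤ L * τ ^ 3 := by
    exact mul_le_mul_of_nonneg_left (pow_le_pow_of_le_one hτ hτ1 (by norm_num)) hL
  have p1 : 0 ≤ τ * (M ^ 2 * ‖x - u‖) := by positivity
  have p2 : 0 ≤ τ * (M ^ 2 * ‖y - v‖) := by positivity
  have p3 : 0 ≤ τ * ‖x - u‖ := by positivity
  have p4 : 0 ≤ τ ^ 3 * (M ^ 2 * G) := by positivity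
  have p5 : 0 ≤ L * τ ^ 3 := by positivity
  linarith

set_option maxHeartbeats 400000 in
/-- Second order convergence of the impulses in the split variables. -/
theorem exists_error_bound (S M Φ κ R γ : ℝ) (hS : 0 ≤ S) (hM : 0 ≤ M) (hΦ : 1 ≤ Φ)
    (hκ : 0 ≤ κ) (hR : 0 ≤ R) (hγ : 0 ≤ γ) :
    ∃ C : ℝ, 0 ≤ C ∧ ∀ (V : Type) [NormedAddCommGroup V] [InnerProductSpace ℝ V]
      (A B D : V →L[ℝ] V) (τ c s φ ψ k q ω a : ℝ) (x y X Y β : ℕ → V) (xe ye Xe Ye be : ℝ → V),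
      IsSplitting A B D τ c s φ ψ x y X Y β → IsFlow A B D ω xe ye Xe Ye be →
      c ^ 2 + s ^ 2 = 1 → ψ * c = 2 * k * s → τ / 2 * φ = q * s * ω⁻¹ → 0 ≤ τ → τ ≤ 1 →
      0 < ω → ω⁻¹ ≤ γ * τ → (∀ v, ‖A v‖ ≤ M * ‖v‖) → (∀ v, ‖B v‖ ≤ M * ‖v‖) →
      (∀ v, ‖D v‖ ≤ M * ‖v‖) → |φ| ≤ Φ → |q| ≤ Φ → |k| ≤ κ →
      x 0 = xe a → y 0 = ye a → X 0 = Xe a → Y 0 = Ye a →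
      β 1 + (τ / 2) • D (y 0 + φ • Y 0) = be a → ‖β 0‖ ≤ R →
      ‖ω • Xe a‖ ≤ R → ‖ω • Ye a‖ ≤ R → ‖ye a‖ ≤ R → ‖be a‖ ≤ R → ‖Ye a‖ ≤ R →
      ∀ n : ℕ, n * τ ≤ S →
        ‖(x n + ω⁻¹ • X n) - (xe (a + n * τ) + ω⁻¹ • Xe (a + n * τ))‖ ≤ C * τ ^ 2 := by
  obtain ⟨G, hG, hnum⟩ := IsSplitting.exists_bound S M Φ κ (R + γ * R) hS hM hΦ hκ (by positivity)
  obtain ⟨H, hH, hex⟩ := IsFlow.exists_bound S M (R + γ * R) hM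
  set L := M ^ 2 * (Φ * G * (1 + 2 * γ)) with hL
  set Le := M ^ 2 * (γ ^ 2 * (2 * H)) with hLe
  set L' := Le + M ^ 2 * H + M ^ 3 * H with hL'
  set K := 1 + 2 * M ^ 2 with hK
  set E := Real.exp (S * K) * (S * (2 * L + M ^ 2 * G + 2 * L')) with hE
  have hΦ0 : 0 ≤ Φ := by linarith
  have hL0 : 0 ≤ L := by positivity
  have hLe0 : 0 ≤ Le := by positivity
  have hL'0 : 0 ≤ L' := by positivity
  have hK0 : 0 ≤ K := by positivity
  have hE0 : 0 ≤ E := by positivity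
  clear_value E L' L Le K
  refine ⟨E + γ * G + γ ^ 2 * H, by positivity, ?_⟩
  intro V _ _ A B D τ c s φ ψ k q ω a x y X Y β xe ye Xe Ye be hs hf hcs hk hq hτ hτ1 hω hωτ hA hB
    hD hφ hqΦ hkκ hx0 hy0 hX0 hY0 hb0 hβ0 hXa hYa hya hba hYa' n hn
  have hω0 : 0 ≤ ω⁻¹ := (inv_pos.2 hω).le
  have hscale : ∀ (v : V) (r : ℝ), ‖ω • v‖ ≤ r → ‖v‖ ≤ γ * τ * r := by
    intro v r hv
    have h1 : v = ω⁻¹ • ω • v := by rw [smul_smul, inv_mul_cancel₀ hω.ne', one_smul]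
    rw [h1, norm_smul, Real.norm_of_nonneg hω0]
    gcongr
  have hγR : 0 ≤ γ * R := by positivity
  have hγRτ : γ * τ * R ≤ (R + γ * R) * τ := by linarith [mul_nonneg hR hτ]
  have hnum' := hnum V A B D τ c s φ ψ k x y X Y β hs hcs hk hτ hτ1 hA hB hD hφ hkκ
    (by rw [hy0]; linarith) (by linarith) (by rw [hX0]; exact (hscale _ _ hXa).trans hγRτ)
    (by rw [hY0]; exact (hscale _ _ hYa).trans hγRτ)
  have hXa' : ‖Xe a‖ ≤ R + γ * R :=
    (hscale _ _ hXa).trans (by linarith [mul_le_of_le_one_right hγR hτ1])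
  have hex' := hex V A B D ω xe ye Xe Ye be hf hA hB hD a (by linarith) (by linarith) (by linarith)
    (by linarith) hXa' (by linarith)
  have haS : a ∈ Set.Icc a (a + S) := ⟨le_rfl, by linarith⟩
  have hforce : ∀ t ∈ Set.Icc a (a + S),
      ‖A (be t) - A (be a + D (xe a - xe t))‖ ≤ Le * τ ^ 2 := by
    intro t ht
    rw [← map_sub, hf.b_eq hω.ne' a t, add_sub_cancel_left]
    refine (norm_comp_le hM hA hD _).trans ?_
    rw [norm_smul, Real.norm_of_nonneg hω0]
    have h1 := hscale _ _ (hex' t ht).1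
    have h2 := hscale _ _ (hex' a haS).1
    calc M ^ 2 * (ω⁻¹ * ‖Xe a - Xe t‖) ≤ M ^ 2 * (γ * τ * (γ * τ * H + γ * τ * H)) := by
          gcongr
          exact (norm_sub_le _ _).trans (add_le_add h2 h1)
      _ = _ := by rw [hLe]; ring
  have hstep : ∀ m < n, ‖x (m + 1) - xe (a + (m + 1 : ℕ) * τ)‖
      + ‖y (m + 1) - ye (a + (m + 1 : ℕ) * τ)‖
      ≤ (1 + τ * K) * (‖x m - xe (a + m * τ)‖ + ‖y m - ye (a + m * τ)‖)
        + (2 * L + M ^ 2 * G + 2 * L') * τ ^ 3 := by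
    intro m hm
    have hm1 : ((m : ℝ) + 1) * τ ≤ S := by
      refine le_trans ?_ hn
      gcongr
      exact_mod_cast hm
    have hmS : m * τ ≤ S := by linarith
    have hm0 : 0 ≤ m * τ := by positivity
    have hsub : ∀ t ∈ Set.Icc (a + m * τ) (a + m * τ + τ), t ∈ Set.Icc a (a + S) :=
      fun t ht => ⟨by linarith [ht.1], by linarith [ht.2]⟩
    obtain ⟨hu, hv⟩ := hf.local_error (a := a) (t := a + m * τ) hM hA hD hτ hτ1 hH hLe0
      (fun t ht => (hex' t (hsub t ht)).2.1) (fun t ht => (hex' t (hsub t ht)).2.2)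
      (fun t ht => hforce t (hsub t ht))
    have hN := hnum' m hmS
    have hw := hs.norm_A_β_succ_sub_le hcs hq hτ hM hA hD hφ hqΦ hω0 hωτ hG
      (hnum' 0 (by simpa using hS)).1 hN.1 hN.2.1
    rw [hb0, hx0, ← hL] at hw
    rw [← hL'] at hu hv
    have e : a + ((m + 1 : ℕ) : ℝ) * τ = a + m * τ + τ := by push_cast; ring
    rw [e, hK]
    refine error_step hM hA hD hτ hτ1 hL0 ?_ (hs.x_succ m) (hs.y_succ m) hN.2.2 hw hu hv
    simp only [map_add, map_sub]
    abel
  have hmain := discrete_gronwall_le (a := fun m : ℕ => ‖x m - xe (a + m * τ)‖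
    + ‖y m - ye (a + m * τ)‖) (δ := τ * K) (L := (2 * L + M ^ 2 * G + 2 * L') * τ ^ 3)
    (by positivity) (by positivity) (by positivity) n hstep n le_rfl
  simp only [Nat.cast_zero, zero_mul, add_zero, hx0, hy0, sub_self, norm_zero, zero_add] at hmain
  have h1 : ‖x n - xe (a + n * τ)‖ ≤ E * τ ^ 2 := by
    calc ‖x n - xe (a + n * τ)‖
        ≤ Real.exp (n * (τ * K)) * (n * ((2 * L + M ^ 2 * G + 2 * L') * τ ^ 3)) := by
          linarith [norm_nonneg (y n - ye (a + n * τ))]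
      _ = Real.exp (n * τ * K) * (n * τ * (2 * L + M ^ 2 * G + 2 * L')) * τ ^ 2 := by ring_nf
      _ ≤ E * τ ^ 2 := by rw [hE]; gcongr
  have hnt : a + n * τ ∈ Set.Icc a (a + S) :=
    ⟨by linarith [mul_nonneg n.cast_nonneg hτ], by linarith⟩
  have h2 := (hnum' n hn).1
  have h3 := hscale _ _ (hex' _ hnt).1
  have e : (x n + ω⁻¹ • X n) - (xe (a + n * τ) + ω⁻¹ • Xe (a + n * τ))
      = (x n - xe (a + n * τ)) + ω⁻¹ • X n - ω⁻¹ • Xe (a + n * τ) := by abel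
  rw [e]
  refine (norm_sub_le _ _).trans ?_
  have h4 := norm_add_le (x n - xe (a + n * τ)) (ω⁻¹ • X n)
  rw [norm_smul, Real.norm_of_nonneg hω0] at h4 ⊢
  have h5 : ω⁻¹ * ‖X n‖ ≤ γ * τ * (G * τ) := by gcongr
  have h6 : ω⁻¹ * ‖Xe (a + n * τ)‖ ≤ γ * τ * (γ * τ * H) := by gcongr
  linarith

end Convergence

section Matrix

variable {d : ℕ}

/-- `mulE` as a continuous linear map. -/
noncomputable def mulECLM (A : Matrix (Fin d) (Fin d) ℝ) :
    EuclideanSpace ℝ (Fin d) →L[ℝ] EuclideanSpace ℝ (Fin d) :=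
  (Matrix.toEuclideanLin A).toContinuousLinearMap

theorem mulECLM_apply (A : Matrix (Fin d) (Fin d) ℝ) (v : EuclideanSpace ℝ (Fin d)) :
    mulECLM A v = mulE A v := rfl

theorem mulE_diagonal_apply (f : Fin d → ℝ) (v : EuclideanSpace ℝ (Fin d)) (i : Fin d) :
    mulE (Matrix.diagonal f) v i = f i * v i :=
  Matrix.mulVec_diagonal f _ i

/-- The orthogonal projection onto the coordinates with nonzero frequency. -/
noncomputable def oscProj (ωv : Fin d → ℝ) :
    EuclideanSpace ℝ (Fin d) →L[ℝ] EuclideanSpace ℝ (Fin d) :=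
  mulECLM (Matrix.diagonal fun i => if ωv i = 0 then 0 else 1)

theorem oscProj_apply (ωv : Fin d → ℝ) (v : EuclideanSpace ℝ (Fin d)) (i : Fin d) :
    oscProj ωv v i = (if ωv i = 0 then 0 else 1) * v i :=
  mulE_diagonal_apply _ _ _

theorem oscProj_oscProj (ωv : Fin d → ℝ) (v : EuclideanSpace ℝ (Fin d)) :
    oscProj ωv (oscProj ωv v) = oscProj ωv v := by
  ext i
  simp only [oscProj_apply]
  split_ifs <;> simp

theorem norm_oscProj_le (ωv : Fin d → ℝ) (v : EuclideanSpace ℝ (Fin d)) :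
    ‖oscProj ωv v‖ ≤ ‖v‖ := by
  rw [EuclideanSpace.norm_eq, EuclideanSpace.norm_eq]
  gcongr with i
  rw [oscProj_apply]
  split_ifs <;> simp

theorem norm_sub_oscProj_le (ωv : Fin d → ℝ) (v : EuclideanSpace ℝ (Fin d)) :
    ‖v - oscProj ωv v‖ ≤ ‖v‖ := by
  rw [EuclideanSpace.norm_eq, EuclideanSpace.norm_eq]
  gcongr with i
  rw [PiLp.sub_apply, oscProj_apply]
  split_ifs <;> simp

variable {ωv : Fin d → ℝ} {ω : ℝ}

theorem mulE_diagonal_eq (hω : ω ≠ 0) (hωv : ∀ i, ωv i = 0 ∨ ωv i = ω) (f : ℝ → ℝ)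
    (v : EuclideanSpace ℝ (Fin d)) :
    mulE (Matrix.diagonal fun i => f (ωv i)) v
      = f 0 • (v - oscProj ωv v) + f ω • oscProj ωv v := by
  ext i
  rw [mulE_diagonal_apply]
  simp only [PiLp.add_apply, PiLp.smul_apply, PiLp.sub_apply, oscProj_apply, smul_eq_mul]
  rcases hωv i with h | h <;> simp [h, hω]

theorem mulE_fDiag_eq (hω : ω ≠ 0) (hωv : ∀ i, ωv i = 0 ∨ ωv i = ω) (f : ℝ → ℝ) (r : ℝ)
    (v : EuclideanSpace ℝ (Fin d)) :
    mulE (fDiag f r ωv) v = f 0 • (v - oscProj ωv v) + f (r * ω) • oscProj ωv v := by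
  rw [fDiag, mulE_diagonal_eq hω hωv (fun w => f (r * w)) v, mul_zero]

theorem mulE_diagonal_self (hω : ω ≠ 0) (hωv : ∀ i, ωv i = 0 ∨ ωv i = ω)
    (v : EuclideanSpace ℝ (Fin d)) :
    mulE (Matrix.diagonal ωv) v = ω • oscProj ωv v := by
  simpa using mulE_diagonal_eq hω hωv id v

theorem mulE_diagonal_sq (hω : ω ≠ 0) (hωv : ∀ i, ωv i = 0 ∨ ωv i = ω)
    (v : EuclideanSpace ℝ (Fin d)) :
    mulE (Matrix.diagonal ωv ^ 2) v = ω ^ 2 • oscProj ωv v := by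
  rw [Matrix.diagonal_pow]
  have h := mulE_diagonal_eq hω hωv (fun w => w ^ 2) v
  simp only [ne_eq, OfNat.ofNat_ne_zero, not_false_eq_true, zero_pow, zero_smul, zero_add] at h
  exact h

end Matrix

section Reduction

variable {d : ℕ} {ωv : Fin d → ℝ} {ω : ℝ}

/-- The part of `mulE A` that maps into the coordinates with zero frequency. -/
noncomputable def slowPart (ωv : Fin d → ℝ) (A : Matrix (Fin d) (Fin d) ℝ) :
    EuclideanSpace ℝ (Fin d) →L[ℝ] EuclideanSpace ℝ (Fin d) :=
  mulECLM A - (oscProj ωv).comp (mulECLM A)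

/-- The part of `mulE A` that maps into the coordinates with nonzero frequency. -/
noncomputable def oscPart (ωv : Fin d → ℝ) (A : Matrix (Fin d) (Fin d) ℝ) :
    EuclideanSpace ℝ (Fin d) →L[ℝ] EuclideanSpace ℝ (Fin d) :=
  (oscProj ωv).comp (mulECLM A)

theorem slowPart_apply (A : Matrix (Fin d) (Fin d) ℝ) (v : EuclideanSpace ℝ (Fin d)) :
    slowPart ωv A v = mulE A v - oscProj ωv (mulE A v) := rfl

theorem oscPart_apply (A : Matrix (Fin d) (Fin d) ℝ) (v : EuclideanSpace ℝ (Fin d)) :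
    oscPart ωv A v = oscProj ωv (mulE A v) := rfl

theorem isFlow_of_maxwell {CE CB : Matrix (Fin d) (Fin d) ℝ} (hω : ω ≠ 0)
    (hωv : ∀ i, ωv i = 0 ∨ ωv i = ω) {p e b : ℝ → EuclideanSpace ℝ (Fin d)}
    (hp : ∀ t, HasDerivAt p (e t) t)
    (he : ∀ t, HasDerivAt e (mulE CB (b t) - mulE ((Matrix.diagonal ωv) ^ 2) (p t)) t)
    (hb : ∀ t, HasDerivAt b (-mulE CE (e t)) t) :
    IsFlow (slowPart ωv CB) (oscPart ωv CB) (mulECLM CE) ω (fun t => p t - oscProj ωv (p t))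
      (fun t => e t - oscProj ωv (e t)) (fun t => ω • oscProj ωv (p t))
      (fun t => oscProj ωv (e t)) b := by
  have hPp := fun t => (oscProj ωv).hasFDerivAt.comp_hasDerivAt t (hp t)
  have hPe := fun t => (oscProj ωv).hasFDerivAt.comp_hasDerivAt t (he t)
  simp only [mulE_diagonal_sq hω hωv] at he hPe
  refine ⟨fun t => (hp t).sub (hPp t), fun t => ((he t).sub (hPe t)).congr_deriv ?_,
    fun t => (hPp t).const_smul ω, fun t => (hPe t).congr_deriv ?_, fun t => ?_⟩
  · simp only [slowPart_apply, map_sub, map_smul, oscProj_oscProj]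
    abel
  · simp only [oscPart_apply, map_sub, map_smul, oscProj_oscProj]
    module
  · simpa only [sub_add_cancel, mulECLM_apply] using hb t

theorem sinc_zero : sinc 0 = 1 := if_pos rfl

theorem mul_sinc (z : ℝ) : z * sinc z = Real.sin z := by
  by_cases h : z = 0
  · simp [h]
  · rw [sinc, if_neg h, mul_div_cancel₀ _ h]

theorem isSplitting_iterate (CE CB : Matrix (Fin d) (Fin d) ℝ) (hω : ω ≠ 0)
    (hωv : ∀ i, ωv i = 0 ∨ ωv i = ω) {ψE φE : ℝ → ℝ} (hψ0 : ψE 0 = 1) (hφ0 : φE 0 = 1) (τ : ℝ)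
    (st : ℕ → EuclideanSpace ℝ (Fin d) × EuclideanSpace ℝ (Fin d) × EuclideanSpace ℝ (Fin d))
    (hst : ∀ n, st (n + 1) = tripleSplitStep CE CB ψE φE τ ωv (st n))
    (β : ℕ → EuclideanSpace ℝ (Fin d))
    (hβ0 : β 0 = (st 0).2.2 + (τ / 2) • mulE CE (((st 0).2.1 - oscProj ωv (st 0).2.1)
      + φE (τ * ω / 2) • oscProj ωv (st 0).2.1))
    (hβ : ∀ n, β (n + 1) = (st n).2.2 - (τ / 2) • mulE CE (((st n).2.1 - oscProj ωv (st n).2.1)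
      + φE (τ * ω / 2) • oscProj ωv (st n).2.1)) :
    IsSplitting (slowPart ωv CB) (oscPart ωv CB) (mulECLM CE) τ (Real.cos (τ * ω / 2))
      (Real.sin (τ * ω / 2)) (φE (τ * ω / 2)) (ψE (τ * ω / 2))
      (fun n => (st n).1 - oscProj ωv (st n).1) (fun n => (st n).2.1 - oscProj ωv (st n).2.1)
      (fun n => ω • oscProj ωv (st n).1) (fun n => oscProj ωv (st n).2.1)
      β := by
  have hcos : Real.cos (τ * ω) = Real.cos (τ * ω / 2) ^ 2 - Real.sin (τ * ω / 2) ^ 2 := by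
    rw [← Real.cos_two_mul']; ring_nf
  have hsin : Real.sin (τ * ω) = 2 * Real.sin (τ * ω / 2) * Real.cos (τ * ω / 2) := by
    rw [← Real.sin_two_mul]; ring_nf
  have hsinc : ω * (τ * sinc (τ * ω)) = 2 * Real.sin (τ * ω / 2) * Real.cos (τ * ω / 2) := by
    rw [← hsin, ← mul_sinc]; ring
  have hhalf : τ / 2 * ω = τ * ω / 2 := by ring
  have hdiag := mulE_diagonal_eq hω hωv (fun w => w * Real.sin (τ * w))
  have hbh : ∀ n, (st n).2.2 - (τ / 2) • mulE CE (mulE (fDiag φE (τ / 2) ωv) (st n).2.1)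
      = β (n + 1) := fun n => by
    rw [hβ, mulE_fDiag_eq hω hωv, hφ0, hhalf, one_smul]
  constructor
  · rintro (_ | n)
    · rw [hβ, hβ0, mulECLM_apply]
      module
    · have hb : (st (n + 1)).2.2
          = ((st n).2.2 - (τ / 2) • mulE CE (mulE (fDiag φE (τ / 2) ωv) (st n).2.1))
            - (τ / 2) • mulE CE (mulE (fDiag φE (τ / 2) ωv) (st (n + 1)).2.1) := by
        rw [hst n]; rfl
      rw [hβ (n + 1), mulECLM_apply, hb, hbh, mulE_fDiag_eq hω hωv, hφ0, hhalf, one_smul]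
      module
  all_goals
    intro n
    rw [hst n]
    simp only [tripleSplitStep, hbh]
    simp only [mulE_fDiag_eq hω hωv, hdiag, hψ0, hhalf, one_smul,
      slowPart_apply, oscPart_apply, map_add, map_sub, map_smul, map_neg, oscProj_oscProj,
      sub_self, zero_mul, zero_smul, zero_add, Real.cos_zero, sinc_zero]
  · module
  · module
  · rw [← hcos, ← hsinc]
    module
  · rw [← hcos, ← hsin]
    module

end Reduction

section Filters

theorem sinc_sq_mul_sq (z : ℝ) : sinc (z / 2) ^ 2 * z ^ 2 = 4 * Real.sin (z / 2) ^ 2 := by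
  rw [← mul_sinc]; ring

theorem abs_sinc_le_one (z : ℝ) : |sinc z| ≤ 1 := by
  by_cases h : z = 0
  · simp [h, sinc_zero]
  · rw [sinc, if_neg h, abs_div]
    exact div_le_one_of_le₀ Real.abs_sin_le_abs (abs_nonneg z)

theorem cos_add_one_eq (z : ℝ) : Real.cos z + 1 = 2 * Real.cos (z / 2) ^ 2 := by
  rw [Real.cos_sq, mul_div_cancel₀ z two_ne_zero]; ring

theorem exists_filter_quotient {φ C z : ℝ} (h : |φ| ≤ C * |sinc (z / 2)|) (hC : 0 ≤ C) :
    ∃ q, φ = q * sinc (z / 2) ∧ |q| ≤ C := by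
  by_cases hs : sinc (z / 2) = 0
  · refine ⟨0, ?_, by simpa using hC⟩
    rw [hs, abs_zero, mul_zero] at h
    rw [abs_nonpos_iff.1 h, zero_mul]
  · refine ⟨φ / sinc (z / 2), (div_mul_cancel₀ _ hs).symm, ?_⟩
    rwa [abs_div, div_le_iff₀ (abs_pos.2 hs)]

theorem exists_tan_factor {ψ C C' a z : ℝ} (ha : 0 < a) (hz : a ≤ z)
    (h : |(Real.cos z + 1) * ψ| ≤ C * sinc (z / 2) ^ 2) (hψ : |ψ| ≤ C') :
    ∃ k, ψ * Real.cos (z / 2) = 2 * k * Real.sin (z / 2) ∧ |k| ≤ |C'| + 4 * |C| / a ^ 2 := by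
  have hz0 : 0 < z := ha.trans_le hz
  have hsc := sinc_sq_mul_sq z
  have hcs := Real.sin_sq_add_cos_sq (z / 2)
  rw [cos_add_one_eq] at h
  set s := Real.sin (z / 2)
  set c := Real.cos (z / 2)
  have hc1 : |c| ≤ 1 := Real.abs_cos_le_one _
  have hs1 : |s| ≤ 1 := Real.abs_sin_le_one _
  rw [abs_mul, abs_of_nonneg (by positivity : (0 : ℝ) ≤ 2 * c ^ 2)] at h
  have hκ : 0 ≤ 4 * |C| / a ^ 2 := by positivity
  have hsin : C * sinc (z / 2) ^ 2 ≤ 4 * |C| / a ^ 2 * s ^ 2 := by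
    have hle : sinc (z / 2) ^ 2 * a ^ 2 ≤ 4 * s ^ 2 :=
      hsc ▸ mul_le_mul_of_nonneg_left (pow_le_pow_left₀ ha.le hz 2) (sq_nonneg _)
    rw [← le_div_iff₀ (by positivity)] at hle
    calc C * sinc (z / 2) ^ 2 ≤ |C| * (4 * s ^ 2 / a ^ 2) :=
          mul_le_mul (le_abs_self C) hle (sq_nonneg _) (abs_nonneg C)
      _ = 4 * |C| / a ^ 2 * s ^ 2 := by ring
  have hsmall : 1 ≤ 2 * c ^ 2 → |ψ| ≤ 4 * |C| / a ^ 2 * s ^ 2 := fun hc =>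
    (le_mul_of_one_le_left (abs_nonneg ψ) hc).trans (h.trans hsin)
  by_cases hs : s = 0
  · refine ⟨0, ?_, by simp only [abs_zero]; positivity⟩
    have := hsmall (by rw [hs] at hcs; linarith)
    rw [hs, zero_pow two_ne_zero, mul_zero, abs_nonpos_iff] at this
    rw [this]; ring
  refine ⟨ψ * c / (2 * s), by field_simp, ?_⟩
  have hs0 := abs_pos.2 hs
  rw [abs_div, div_le_iff₀ (by positivity), abs_mul, abs_mul, abs_two]
  have hψc : |ψ| * |c| ≤ |ψ| := mul_le_of_le_one_right (abs_nonneg ψ) hc1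
  have hsq : s ^ 2 = |s| * |s| := by rw [← sq, sq_abs]
  have hC' := hψ.trans (le_abs_self C')
  rcases le_total 1 (2 * c ^ 2) with hc | hc
  · have := hsmall hc
    have h1 : s ^ 2 ≤ |s| := hsq ▸ mul_le_of_le_one_left hs0.le hs1
    have h2 := mul_le_mul_of_nonneg_left h1 hκ
    have h3 := mul_nonneg (abs_nonneg C') hs0.le
    have h4 := mul_nonneg hκ hs0.le
    linarith
  · have h1 : 1 ≤ 2 * |s| := by nlinarith
    have h2 := mul_le_mul_of_nonneg_left h1 (abs_nonneg C')
    have h3 := mul_nonneg hκ hs0.le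
    linarith

end Filters

/-- Second order error bound for the impulses: under filter
conditions (i)–(viii), the initial-data bounds and `0 < τ ≤ τ₀`, `τ·ω̃ ≥ c₀`, the
impulse iterates of the triple splitting scheme satisfy
`‖p_n − p(t_n)‖ ≤ C·τ²` for all `n` with `t_n = t₀ + n·τ ≤ T`, with `τ₀, C`
independent of `ω̃`, `τ`, `n`, `d`. -/
theorem stmt5
    (t0 T c0 H0 Cc C1 C2 C3 C4 C5 C6 C7 C8 : ℝ)
    (hT : t0 < T) (hc0 : 0 < c0) (hH0 : 0 < H0) (hCc : 0 < Cc) :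
    ∃ τ0 : ℝ, 0 < τ0 ∧ ∃ C : ℝ, 0 < C ∧
      ∀ (d : ℕ), 1 ≤ d →
      ∀ (CE CB : Matrix (Fin d) (Fin d) ℝ), CB = CE.transpose →
      ∀ (ow : ℝ), 0 < ow →
      ∀ (ωv : Fin d → ℝ), (∀ i, ωv i = 0 ∨ ωv i = ow) →
      (∀ v : EuclideanSpace ℝ (Fin d), ‖mulE CE v‖ ≤ Cc * ‖v‖) →
      (∀ v : EuclideanSpace ℝ (Fin d), ‖mulE CB v‖ ≤ Cc * ‖v‖) →
      ∀ (ψE φE : ℝ → ℝ),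
        (∀ z, ψE (-z) = ψE z) → (∀ z, φE (-z) = φE z) → ψE 0 = 1 → φE 0 = 1 →
        (∀ z : ℝ, |(Real.cos z + 1) * ψE (z/2)| ≤ C1 * (sinc (z/2))^2) →
        (∀ z : ℝ, |φE (z/2)| ≤ C2 * |sinc (z/2)|) →
        (∀ z : ℝ, |(Real.cos z + 1) * ψE (z/2) * φE (z/2)| ≤ C3 * |sinc z|) →
        (∀ z : ℝ, |(Real.cos z + 1) * ψE (z/2)| ≤ C4 * |sinc z|) →
        (∀ z : ℝ, |sinc z - (1/2) * (Real.cos z + 1) * ψE (z/2)| ≤ C5 * z^2 * |sinc z|) →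
        (∀ z : ℝ, |sinc z - φE (z/2)| ≤ C6 * |z * Real.sin (z/2)|) →
        (∀ z : ℝ, |ψE z| ≤ C7) →
        (∀ z : ℝ, |(sinc (z/2))^2 - sinc z * φE (z/2)| ≤ C8 * (Real.sin (z/2))^2) →
      ∀ (p0 e0 b0 : EuclideanSpace ℝ (Fin d)),
        ‖mulE (Matrix.diagonal ωv) e0‖^2 ≤ (2/3) * H0 →
        ‖mulE CB b0‖^2 ≤ (1/3) * min 1 (4 / C4^2) * H0 →
        ‖mulE ((Matrix.diagonal ωv)^2) p0‖^2 ≤ (1/3) * H0 →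
        ‖mulE CE e0‖^2 ≤ 2 * H0 →
        ‖e0‖^2 ≤ H0 →
        ‖b0‖^2 ≤ H0 →
        ‖mulE ((Matrix.diagonal ωv)^2) (mulE CB b0)‖^2 ≤ H0 →
      ∀ (p e b : ℝ → EuclideanSpace ℝ (Fin d)),
        (∀ t, HasDerivAt p (e t) t) →
        (∀ t, HasDerivAt e (mulE CB (b t) - mulE ((Matrix.diagonal ωv)^2) (p t)) t) →
        (∀ t, HasDerivAt b (-mulE CE (e t)) t) →
        p t0 = p0 → e t0 = e0 → b t0 = b0 →
      ∀ (τ : ℝ), 0 < τ → τ ≤ τ0 → c0 ≤ τ * ow →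
      ∀ n : ℕ, t0 + (n : ℝ) * τ ≤ T →
        ‖((tripleSplitStep CE CB ψE φE τ ωv)^[n] (p0, e0, b0)).1
            - p (t0 + (n : ℝ) * τ)‖ ≤ C * τ^2 := by
  have hH := Real.sqrt_nonneg H0
  obtain ⟨C, hC0, hC⟩ := exists_error_bound (T - t0) Cc (max 1 C2) (|C7| + 4 * |C1| / c0 ^ 2)
    (√H0 + Cc * ((1 + max 1 C2) * √H0)) (1 / c0) (sub_nonneg.2 hT.le) hCc.le (le_max_left _ _)
    (by positivity) (by positivity) (by positivity)
  refine ⟨1, one_pos, C + 1, by positivity, ?_⟩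
  intro d _ CE CB _ ow how ωv hωv hCE hCB ψE φE _ _ hψ0 hφ0 hi hii _ _ _ _ hvii _ p0 e0 b0
    hΩe _ hΩp _ he0 hb0 _ p e b hp he hb hpt het hbt τ hτ hτ1 hτω n hn
  have how' := how.ne'
  have hle : ∀ {x : ℝ} {v : EuclideanSpace ℝ (Fin d)}, ‖v‖ ^ 2 ≤ x → x ≤ H0 →
      ‖v‖ ≤ √H0 := fun h h' => Real.le_sqrt_of_sq_le (h.trans h')
  have hΦ1 : 1 ≤ max 1 C2 := le_max_left _ _
  have hφ : |φE (τ * ow / 2)| ≤ max 1 C2 * |sinc (τ * ow / 2)| :=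
    (hii _).trans (mul_le_mul_of_nonneg_right (le_max_right _ _) (abs_nonneg _))
  have hφ' : |φE (τ * ow / 2)| ≤ max 1 C2 :=
    hφ.trans (mul_le_of_le_one_right (by positivity) (abs_sinc_le_one _))
  obtain ⟨q, hq, hqΦ⟩ := exists_filter_quotient hφ (by positivity)
  obtain ⟨k, hk, hkκ⟩ := exists_tan_factor hc0 hτω (hi _) (hvii (τ * ow / 2))
  have he0' := hle he0 le_rfl
  have hb0' := hle hb0 le_rfl
  have hΩp' := hle hΩp (by linarith)
  have hΩe' := hle hΩe (by linarith)
  rw [mulE_diagonal_sq how' hωv] at hΩp'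
  rw [mulE_diagonal_self how' hωv] at hΩe'
  have hR : √H0 ≤ √H0 + Cc * ((1 + max 1 C2) * √H0) :=
    le_add_of_nonneg_right (by positivity)
  set st := fun n => (tripleSplitStep CE CB ψE φE τ ωv)^[n] (p0, e0, b0) with hst
  have hst_succ : ∀ n, st (n + 1) = tripleSplitStep CE CB ψE φE τ ωv (st n) :=
    fun n => Function.iterate_succ_apply' _ _ _
  have hfe : ‖mulE CE ((e0 - oscProj ωv e0) + φE (τ * ow / 2) • oscProj ωv e0)‖
      ≤ Cc * ((1 + max 1 C2) * √H0) := by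
    refine (hCE _).trans (mul_le_mul_of_nonneg_left ?_ hCc.le)
    refine (norm_add_le _ _).trans ?_
    rw [norm_smul, Real.norm_eq_abs, add_mul, one_mul]
    exact add_le_add ((norm_sub_oscProj_le _ _).trans he0')
      (mul_le_mul hφ' ((norm_oscProj_le _ _).trans he0') (norm_nonneg _) (by positivity))
  let β : ℕ → EuclideanSpace ℝ (Fin d) := fun n => n.casesOn
    (b0 + (τ / 2) • mulE CE ((e0 - oscProj ωv e0) + φE (τ * ow / 2) • oscProj ωv e0))
    (fun n => (st n).2.2 - (τ / 2) • mulE CE (((st n).2.1 - oscProj ωv (st n).2.1)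
      + φE (τ * ow / 2) • oscProj ωv (st n).2.1))
  have hscheme := isSplitting_iterate CE CB how' hωv hψ0 hφ0 τ st hst_succ β rfl fun _ => rfl
  have hflow := isFlow_of_maxwell how' hωv hp he hb
  have key := hC _ _ _ _ τ _ _ _ _ k q ow t0 _ _ _ _ _ _ _ _ _ _ hscheme hflow
    (Real.cos_sq_add_sin_sq _) hk
    (by rw [← mul_sinc, hq]; field_simp) hτ.le hτ1 how
    (by rw [inv_le_iff_one_le_mul₀ how, one_div_mul_eq_div, div_mul_eq_mul_div, one_le_div hc0]
        exact hτω)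
    (fun v => (norm_sub_oscProj_le _ _).trans (hCB v))
    (fun v => (norm_oscProj_le _ _).trans (hCB v)) hCE hφ' hqΦ hkκ
    (by simp [hst, hpt]) (by simp [hst, het]) (by simp [hst, hpt]) (by simp [hst, het])
    (by
      rw [hbt]
      exact sub_add_cancel _ _)
    (by
      refine (norm_add_le _ _).trans (add_le_add hb0' ?_)
      rw [norm_smul, Real.norm_eq_abs, abs_of_pos (half_pos hτ)]
      exact (mul_le_of_le_one_left (norm_nonneg _) (by linarith)).trans hfe)
    (by rw [hpt, smul_smul, ← sq]; exact hΩp'.trans hR)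
    (by rw [het]; exact hΩe'.trans hR)
    (by rw [het]; exact ((norm_sub_oscProj_le _ _).trans he0').trans hR)
    (by rw [hbt]; exact hb0'.trans hR)
    (by rw [het]; exact ((norm_oscProj_le _ _).trans he0').trans hR) n (by linarith)
  simp only [inv_smul_smul₀ how', sub_add_cancel] at key
  exact key.trans (mul_le_mul_of_nonneg_right (by linarith) (sq_nonneg τ))
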